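/- arXiv:1607.07618 — 4 statements merged into one kernel-verified Lean document; each statement's English description precedes it below -/
import Mathlib

section
/- The set of natural numbers n for which there exists a 4-element subset S of G = (ℤ/3ℤ) × (ℤ/3ℤ) whose number of collinear triples equals n is exactly {0, 1}. Here a collinear triple of S is a 3-element subset T ⊆ S with ∑_{x∈T} x = 0. -/
/-- A finite set has at most one zero-sum subset obtained by removing a single element: the removed
element must be the sum of the whole set. -/
theorem Finset.card_filter_powersetCard_sum_eq_zero_le_one {G : Type*} [AddCommGroup G]
    [DecidableEq G] {S : Finset G} {k : ℕ} (hS : S.card = k + 1) :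
    ((S.powersetCard k).filter (fun T => ∑ x ∈ T, x = 0)).card ≤ 1 := by
  have eq_erase : ∀ T ∈ (S.powersetCard k).filter (fun T => ∑ x ∈ T, x = 0),
      T = S \ {∑ x ∈ S, x} := by
    intro T hT
    obtain ⟨hT, hsum⟩ := Finset.mem_filter.mp hT
    obtain ⟨hTS, hcard⟩ := Finset.mem_powersetCard.mp hT
    obtain ⟨a, ha⟩ : ∃ a, S \ T = {a} := by
      rw [← Finset.card_eq_one, Finset.card_sdiff_of_subset hTS]
      lia
    have h := Finset.sum_sdiff (f := fun x : G => x) hTS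
    rw [ha, hsum, Finset.sum_singleton, add_zero] at h
    rw [← h, ← ha, Finset.sdiff_sdiff_eq_self hTS]
  exact Finset.card_le_one.mpr fun T hT U hU => (eq_erase T hT).trans (eq_erase U hU).symm

/-- The possible numbers of collinear triples (three-element zero-sum subsets)
in a 4-element subset of `(ℤ/3ℤ) × (ℤ/3ℤ)` are exactly `0` and `1`. -/
theorem collinear_triples_card_four :
    {n : ℕ | ∃ S : Finset (ZMod 3 × ZMod 3), S.card = 4 ∧
      ((S.powersetCard 3).filter (fun T => ∑ x ∈ T, x = 0)).card = n} = {0, 1} := by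
  ext n
  simp only [Set.mem_ofPred_eq, Set.mem_insert_iff, Set.mem_singleton_iff]
  constructor
  · rintro ⟨S, hS, rfl⟩
    have := Finset.card_filter_powersetCard_sum_eq_zero_le_one hS
    lia
  · rintro (rfl | rfl)
    · exact ⟨{(0, 0), (0, 1), (1, 0), (1, 1)}, by decide, by decide⟩
    · exact ⟨{(0, 0), (0, 1), (0, 2), (1, 0)}, by decide, by decide⟩
end

section
/- The set of natural numbers n for which there exists a 6-element subset S of G = (ℤ/3ℤ) × (ℤ/3ℤ) whose number of collinear triples equals n is exactly {2, 3}. Here a collinear triple of S is a 3-element subset T ⊆ S with ∑_{x∈T} x = 0. -/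
/-- A 6-element subset of `(ℤ/3ℤ) × (ℤ/3ℤ)` has two or three zero-sum triples. -/
theorem card_zero_sum_triples_of_card_six :
    ∀ S ∈ (Finset.univ : Finset (ZMod 3 × ZMod 3)).powersetCard 6,
      ((S.powersetCard 3).filter (fun T => ∑ x ∈ T, x = 0)).card = 2 ∨
      ((S.powersetCard 3).filter (fun T => ∑ x ∈ T, x = 0)).card = 3 := by
  decide +kernel

/-- The possible numbers of collinear triples (three-element zero-sum subsets)
in a 6-element subset of `(ℤ/3ℤ) × (ℤ/3ℤ)` are exactly `2` and `3`. -/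
theorem collinear_triples_card_six :
    {n : ℕ | ∃ S : Finset (ZMod 3 × ZMod 3), S.card = 6 ∧
      ((S.powersetCard 3).filter (fun T => ∑ x ∈ T, x = 0)).card = n} = {2, 3} := by
  ext n
  simp only [Set.mem_ofPred_eq, Set.mem_insert_iff, Set.mem_singleton_iff]
  constructor
  · rintro ⟨S, hS, rfl⟩
    exact card_zero_sum_triples_of_card_six S
      (Finset.mem_powersetCard.2 ⟨Finset.subset_univ S, hS⟩)
  · rintro (rfl | rfl)
    · exact ⟨{(0, 0), (0, 1), (0, 2), (1, 0), (1, 1), (1, 2)}, by decide +kernel⟩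
    · exact ⟨{(0, 0), (0, 1), (0, 2), (1, 0), (1, 1), (2, 0)}, by decide +kernel⟩
end

section
/- Every 7-element subset S of G = (ℤ/3ℤ) × (ℤ/3ℤ) has exactly 5 collinear triples, i.e., exactly 5 three-element subsets T ⊆ S with ∑_{x∈T} x = 0. -/
/-- Deleting two points from `(ℤ/3ℤ) × (ℤ/3ℤ)` leaves exactly 5 collinear triples. -/
theorem card_collinear_triples_compl_pair :
    ∀ a b : ZMod 3 × ZMod 3, a ≠ b →
      (((({a, b} : Finset (ZMod 3 × ZMod 3))ᶜ).powersetCard 3).filter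
        (fun T => ∑ x ∈ T, x = 0)).card = 5 := by
  decide +kernel

/-- Every 7-element subset of `(ℤ/3ℤ) × (ℤ/3ℤ)` contains exactly 5 collinear
triples, i.e. three-element subsets summing to zero. -/
theorem collinear_triples_card_seven (S : Finset (ZMod 3 × ZMod 3)) (hS : S.card = 7) :
    ((S.powersetCard 3).filter (fun T => ∑ x ∈ T, x = 0)).card = 5 := by
  have hcompl : Sᶜ.card = 2 := by
    simp [Finset.card_compl, hS, ZMod.card]
  obtain ⟨a, b, hab, h⟩ := Finset.card_eq_two.mp hcompl
  rw [← compl_compl S, h]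
  exact card_collinear_triples_compl_pair a b hab
end

section
/- Every 8-element subset S of G = (ℤ/3ℤ) × (ℤ/3ℤ) has exactly 8 collinear triples, i.e., exactly 8 three-element subsets T ⊆ S with ∑_{x∈T} x = 0. -/
/-- Every 8-element subset of `(ℤ/3ℤ) × (ℤ/3ℤ)` contains exactly 8 collinear
triples, i.e. three-element subsets summing to zero. -/
theorem collinear_triples_card_eight (S : Finset (ZMod 3 × ZMod 3)) (hS : S.card = 8) :
    ((S.powersetCard 3).filter (fun T => ∑ x ∈ T, x = 0)).card = 8 := by
  have hcompl : Sᶜ.card = 1 := by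
    rw [Finset.card_compl, hS]
    simp [ZMod.card]
  obtain ⟨p, hp⟩ := Finset.card_eq_one.mp hcompl
  obtain rfl : S = {p}ᶜ := by rw [← hp, compl_compl]
  clear hp hcompl hS
  revert p
  decide +kernel
end
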